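/- Let N = 1 and s ∈ (0,1). Assume K satisfies (K1) and (K2) and W satisfies (W1)–(W4), and let u0 be the minimizer of Theorem 1 (odd, strictly increasing, u0 : ℝ → (−1,1) of class C^{1+2s+α}(ℝ) for some α > 0, lim_{x→±∞} u0(x) = ±1, solving L_K u0 = W'(u0) pointwise on ℝ). Then there exist constants C ≥ 1 and R1 > 0 such that for every x ∈ ℝ with |x| ≥ R1 one has |u0(x) − sign(x)| ≤ C·|x|^{−2s} and |u0'(x)| ≤ C·|x|^{−1−2s}. -/

import Mathlib

open MeasureTheory Filter Topology Set
open scoped ENNReal NNReal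

noncomputable section

/-- The non-local Gagliardo-type + potential energy `E_K(u, Ω)`. -/
def nlEnergy {E : Type*} [MeasurableSpace E] [Sub E] (μ : Measure E)
    (K : E → ℝ) (W : ℝ → ℝ) (u : E → ℝ) (Ω : Set E) : ℝ≥0∞ :=
  (1 / 4) * ∫⁻ p in ((Ωᶜ ×ˢ Ωᶜ)ᶜ : Set (E × E)),
      ENNReal.ofReal ((u p.1 - u p.2) ^ 2 * K (p.1 - p.2)) ∂(μ.prod μ)
    + ∫⁻ x in Ω, ENNReal.ofReal (W (u x)) ∂μ

/-- `u` is a local minimizer of `E_K` in `Ω`. -/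
def IsLocalMinimizer {E : Type*} [MeasurableSpace E] [Sub E] (μ : Measure E)
    (K : E → ℝ) (W : ℝ → ℝ) (u : E → ℝ) (Ω : Set E) : Prop :=
  nlEnergy μ K W u Ω ≠ ⊤ ∧
    ∀ v : E → ℝ, Measurable v → (∀ᵐ x ∂μ, x ∉ Ω → v x = u x) →
      nlEnergy μ K W u Ω ≤ nlEnergy μ K W v Ω

/-- `u` is a class A minimizer of `E_K`: a local minimizer in every bounded domain. -/
def IsClassAMinimizer {E : Type*} [NormedAddCommGroup E] [MeasurableSpace E] (μ : Measure E)
    (K : E → ℝ) (W : ℝ → ℝ) (u : E → ℝ) : Prop :=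
  ∀ Ω : Set E, IsOpen Ω → IsConnected Ω → Bornology.IsBounded Ω →
    IsLocalMinimizer μ K W u Ω

/-- The integro-differential operator `L_K`, in its non-singular form
`L_K u (x) = (1/2) ∫ (u(x+z) + u(x-z) - 2 u(x)) K(z) dz`. -/
def opLK {E : Type*} [NormedAddCommGroup E] [MeasurableSpace E] (μ : Measure E)
    (K : E → ℝ) (u : E → ℝ) (x : E) : ℝ :=
  (1 / 2) * ∫ z, (u (x + z) + u (x - z) - 2 * u x) * K z ∂μ

/-- (K1): the kernel is symmetric. -/
def KernelSymm {E : Type*} [MeasurableSpace E] [Neg E] (μ : Measure E) (K : E → ℝ) : Prop :=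
  ∀ᵐ z ∂μ, K (-z) = K z

/-- (K2): `λ χ_{B_{r0}}(z) |z|^{-N-2s} ≤ K(z) ≤ Λ |z|^{-N-2s}` for a.e. `z`. -/
def KernelK2 {E : Type*} [NormedAddCommGroup E] [MeasurableSpace E] (μ : Measure E)
    (K : E → ℝ) (N : ℕ) (s lam Lam r0 : ℝ) : Prop :=
  ∀ᵐ z ∂μ, K z ≤ Lam * ‖z‖ ^ (-(N : ℝ) - 2 * s) ∧
    (‖z‖ < r0 → lam * ‖z‖ ^ (-(N : ℝ) - 2 * s) ≤ K z)

/-- (K2'): `λ |z|^{-N-2s} ≤ K(z) ≤ Λ |z|^{-N-2s}` for a.e. `z`. -/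
def KernelK2' {E : Type*} [NormedAddCommGroup E] [MeasurableSpace E] (μ : Measure E)
    (K : E → ℝ) (N : ℕ) (s lam Lam : ℝ) : Prop :=
  ∀ᵐ z ∂μ, lam * ‖z‖ ^ (-(N : ℝ) - 2 * s) ≤ K z ∧ K z ≤ Lam * ‖z‖ ^ (-(N : ℝ) - 2 * s)

/-- `W` is of class `C^{2,β}_loc(ℝ)`. -/
def IsC2HolderLoc (β : ℝ) (W : ℝ → ℝ) : Prop :=
  ContDiff ℝ 2 W ∧ ∀ R : ℝ, 0 < R → ∃ C : NNReal,
    HolderOnWith C β.toNNReal (deriv (deriv W)) (Icc (-R) R)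

/-- `f` is of (global) class `C^γ`: it is `C^{⌊γ⌋}` and the `⌊γ⌋`-th derivative is
globally Hölder continuous with exponent `γ - ⌊γ⌋`. -/
def IsCHolder {E F : Type*} [NormedAddCommGroup E] [NormedSpace ℝ E]
    [NormedAddCommGroup F] [NormedSpace ℝ F] (γ : ℝ) (f : E → F) : Prop :=
  ContDiff ℝ (⌊γ⌋₊ : ℕ) f ∧ ∃ C : NNReal,
    HolderWith C (γ - ⌊γ⌋₊).toNNReal (iteratedFDeriv ℝ ⌊γ⌋₊ f)

/-- `f` is of class `C^γ` on the set `Ω`. -/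
def IsCHolderOn {E F : Type*} [NormedAddCommGroup E] [NormedSpace ℝ E]
    [NormedAddCommGroup F] [NormedSpace ℝ F] (γ : ℝ) (f : E → F) (Ω : Set E) : Prop :=
  ContDiffOn ℝ (⌊γ⌋₊ : ℕ) f Ω ∧ ∃ C : NNReal,
    HolderOnWith C (γ - ⌊γ⌋₊).toNNReal (iteratedFDerivWithin ℝ ⌊γ⌋₊ f Ω) Ω

/-- The scaling factor `Ψ_s(R)`. -/
def Psi (s R : ℝ) : ℝ :=
  if s < 1 / 2 then R ^ (1 - 2 * s) else if s = 1 / 2 then Real.log R else 1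

/-- The symmetric second difference `u (x + z) + u (x - z) - 2 u x`. -/
def secondDiff (u : ℝ → ℝ) (x z : ℝ) : ℝ := u (x + z) + u (x - z) - 2 * u x

lemma integrable_comp_abs_of_integrableOn_Ioi {f : ℝ → ℝ} (hf : IntegrableOn f (Ioi 0)) :
    Integrable (fun x => f |x|) := by
  have h1 : IntegrableOn (fun x => f |x|) (Ioi 0) :=
    hf.congr_fun (fun x hx => by simp [abs_of_pos (mem_Ioi.1 hx)]) measurableSet_Ioi
  have h2 : IntegrableOn (fun x => f |x|) (Iic 0) := by
    rw [integrableOn_Iic_iff_integrableOn_Iio]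
    have := (integrable_indicator_iff measurableSet_Ioi).2 h1
    have h3 := this.comp_neg
    rw [← integrable_indicator_iff measurableSet_Iio]
    refine h3.congr (Eventually.of_forall fun x => ?_)
    simp [indicator]
  have := h2.union h1
  rwa [Iic_union_Ioi, integrableOn_univ] at this

lemma integrable_min_one_rpow_mul {s p : ℝ} (hs0 : 0 < s) (hp : 2 * s < p) :
    Integrable (fun z : ℝ => min 1 (|z| ^ p) * |z| ^ (-1 - 2 * s)) := by
  refine integrable_comp_abs_of_integrableOn_Ioi
    (f := fun z => min 1 (z ^ p) * z ^ (-1 - 2 * s)) ?_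
  rw [← Ioc_union_Ioi_eq_Ioi zero_le_one]
  refine IntegrableOn.union ?_ ?_
  · have h : IntegrableOn (fun z : ℝ => z ^ (p - 1 - 2 * s)) (Ioc 0 1) := by
      rw [← intervalIntegrable_iff_integrableOn_Ioc_of_le zero_le_one]
      exact intervalIntegral.intervalIntegrable_rpow' (by linarith)
    refine h.congr_fun (fun z hz => ?_) measurableSet_Ioc
    have : z ^ p ≤ 1 := Real.rpow_le_one hz.1.le hz.2 (by linarith)
    simp only [min_eq_right this]
    rw [← Real.rpow_add hz.1]
    congr 1; ring
  · refine (integrableOn_Ioi_rpow_of_lt (a := -1 - 2 * s) (by linarith) one_pos).congr_fun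
      (fun z hz => ?_) measurableSet_Ioi
    have : 1 ≤ z ^ p := Real.one_le_rpow (mem_Ioi.1 hz).le (by linarith)
    simp [min_eq_left this]

/-- The pointwise bounds on a kernel used throughout. -/
structure KernelBound (J : ℝ → ℝ) (s Lam : ℝ) : Prop where
  meas : Measurable J
  nonneg : ∀ z, 0 ≤ J z
  le : ∀ᵐ z, J z ≤ Lam * |z| ^ (-1 - 2 * s)

lemma KernelBound.integrable_min {J : ℝ → ℝ} {s Lam p : ℝ} (hJ : KernelBound J s Lam)
    (hs0 : 0 < s) (hp : 2 * s < p) :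
    Integrable (fun z : ℝ => min 1 (|z| ^ p) * J z) := by
  refine ((integrable_min_one_rpow_mul hs0 hp).const_mul Lam).mono' ?_ ?_
  · have := hJ.meas
    exact Measurable.aestronglyMeasurable (by fun_prop)
  · filter_upwards [hJ.le] with z hz
    have h0 : 0 ≤ min 1 (|z| ^ p) := le_min zero_le_one (by positivity)
    rw [Real.norm_of_nonneg (mul_nonneg h0 (hJ.nonneg z))]
    nlinarith [mul_le_mul_of_nonneg_left hz h0]

lemma KernelBound.integrable_mul {J F : ℝ → ℝ} {s Lam p C : ℝ} (hJ : KernelBound J s Lam)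
    (hs0 : 0 < s) (hp : 2 * s < p) (hF : Measurable F)
    (hC : ∀ z, |F z| ≤ C * min 1 (|z| ^ p)) :
    Integrable (fun z : ℝ => F z * J z) := by
  refine ((hJ.integrable_min hs0 hp).const_mul C).mono' ?_ ?_
  · exact (hF.mul hJ.meas).aestronglyMeasurable
  · filter_upwards with z
    rw [norm_mul, Real.norm_of_nonneg (hJ.nonneg z), ← mul_assoc]
    exact mul_le_mul_of_nonneg_right (hC z) (hJ.nonneg z)

lemma secondDiff_neg (u : ℝ → ℝ) (x z : ℝ) : secondDiff u x (-z) = secondDiff u x z := by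
  simp only [secondDiff, sub_neg_eq_add, ← sub_eq_add_neg]; ring

lemma secondDiff_abs (u : ℝ → ℝ) (x z : ℝ) : secondDiff u x |z| = secondDiff u x z := by
  rcases abs_choice z with h | h <;> rw [h]
  exact secondDiff_neg u x z

lemma abs_secondDiff_le {f : ℝ → ℝ} {x z C θ : ℝ} (hθ : 0 ≤ θ) (hC : 0 ≤ C)
    (hd : ∀ y ∈ Icc (x - |z|) (x + |z|), DifferentiableAt ℝ f y)
    (hb : ∀ a ∈ Icc (x - |z|) (x + |z|), ∀ b ∈ Icc (x - |z|) (x + |z|),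
      |deriv f a - deriv f b| ≤ C * |a - b| ^ θ) :
    |secondDiff f x z| ≤ C * 2 ^ θ * |z| ^ (1 + θ) := by
  rcases eq_or_ne z 0 with rfl | hz
  · have : secondDiff f x 0 = 0 := by simp [secondDiff]; ring
    rw [this, abs_zero]; positivity
  rw [← secondDiff_abs]
  have hz' : 0 < |z| := abs_pos.2 hz
  generalize |z| = w at *
  have hg : ∀ t ∈ Icc 0 w, HasDerivAt (fun t => f (x + t) + f (x - t))
      (deriv f (x + t) - deriv f (x - t)) t := by
    intro t ht
    have h1 := (hd (x + t) ⟨by linarith [ht.1], by linarith [ht.2]⟩).hasDerivAt.comp_const_add x t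
    have h2 := (hd (x - t) ⟨by linarith [ht.2], by linarith [ht.1]⟩).hasDerivAt.comp_const_sub x t
    exact (h1.add h2).congr_deriv (by ring)
  obtain ⟨ξ, hξ, h⟩ := exists_hasDerivAt_eq_slope (fun t => f (x + t) + f (x - t)) _ hz'
    (fun t ht => (hg t ht).continuousAt.continuousWithinAt)
    (fun t ht => hg t (Ioo_subset_Icc_self ht))
  have hξ0 := hξ.1
  have hξw := hξ.2
  have key : secondDiff f x w = (deriv f (x + ξ) - deriv f (x - ξ)) * w := by
    rw [h, sub_zero w, div_mul_cancel₀ _ hz'.ne']; simp [secondDiff]; ring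
  rw [key, abs_mul, abs_of_pos hz']
  have h2 := hb (x + ξ) ⟨by linarith, by linarith⟩ (x - ξ) ⟨by linarith, by linarith⟩
  have h3 : |x + ξ - (x - ξ)| ^ θ ≤ 2 ^ θ * w ^ θ := by
    rw [← Real.mul_rpow (by norm_num) hz'.le]
    refine Real.rpow_le_rpow (abs_nonneg _) ?_ hθ
    rw [abs_le]; constructor <;> linarith
  calc _ ≤ C * (2 ^ θ * w ^ θ) * w := by gcongr; exact h2.trans (by gcongr)
    _ = _ := by rw [Real.rpow_add hz', Real.rpow_one]; ring

lemma exists_abs_deriv_sub_le {f : ℝ → ℝ} (a b : ℝ) (hf : ∀ y ∈ Icc a b, ContDiffAt ℝ 2 f y) :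
    ∃ C, 0 ≤ C ∧ ∀ x ∈ Icc a b, ∀ y ∈ Icc a b, |deriv f x - deriv f y| ≤ C * |x - y| := by
  have h1 : ∀ y ∈ Icc a b, ContDiffAt ℝ 1 (deriv f) y := fun y hy => by
    exact (hf y hy).derivWithin (m := 1) (by norm_num)
  obtain ⟨C, hC⟩ := isCompact_Icc.exists_bound_of_continuousOn (s := Icc a b) (f := deriv (deriv f))
    (fun y hy => ((h1 y hy).derivWithin (m := 0) (by norm_num)).continuousAt.continuousWithinAt)
  refine ⟨|C|, abs_nonneg _, fun x hx y hy => ?_⟩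
  have := (convex_Icc a b).norm_image_sub_le_of_norm_deriv_le (f := deriv f) (C := |C|)
    (fun z hz => (h1 z hz).differentiableAt one_ne_zero)
    (fun z hz => (hC z hz).trans (le_abs_self C)) hy hx
  simpa using this

lemma IsCHolder.exists_abs_secondDiff_le {u : ℝ → ℝ} {s α : ℝ} (hs0 : 0 < s) (hs1 : s < 1)
    (hα : 0 < α) (hu : IsCHolder (1 + 2 * s + α) u) (hb : ∀ x, |u x| ≤ 1) :
    ∃ p, 2 * s < p ∧ ∀ R, ∃ C, 0 ≤ C ∧ ∀ x, |x| ≤ R → ∀ z,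
      |secondDiff u x z| ≤ C * min 1 (|z| ^ p) := by
  obtain ⟨hc, C, hC⟩ := hu
  have hsuff : ∃ p, 2 * s < p ∧ ∀ R, ∃ C, 0 ≤ C ∧ ∀ x, |x| ≤ R → ∀ z, |z| ≤ 1 →
      |secondDiff u x z| ≤ C * |z| ^ p := by
    have hm : 1 ≤ ⌊1 + 2 * s + α⌋₊ := Nat.le_floor (by push_cast; linarith)
    have hm' := Nat.floor_le (a := 1 + 2 * s + α) (by linarith)
    generalize ⌊1 + 2 * s + α⌋₊ = m at *
    rcases hm.eq_or_lt with rfl | hm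
    · refine ⟨1 + (1 + 2 * s + α - (1 : ℕ)), by push_cast; linarith, fun R =>
        ⟨C * 2 ^ (1 + 2 * s + α - (1 : ℕ)), by positivity, fun x _ z _ => ?_⟩⟩
      refine abs_secondDiff_le (by linarith) C.2
        (fun y _ => hc.differentiable (by simp) y) fun a _ b _ => ?_
      have h1 := hC.dist_le a b
      have h2 : ∀ x, deriv u x = iteratedFDeriv ℝ 1 u x (fun _ => 1) := fun x => by
        rw [← iteratedDeriv_eq_iteratedFDeriv, iteratedDeriv_one]
      rw [Real.coe_toNNReal _ (by linarith), dist_eq_norm, Real.dist_eq] at h1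
      refine le_trans ?_ h1
      rw [h2, h2, ← sub_apply, ← Real.norm_eq_abs]
      refine (ContinuousMultilinearMap.le_opNorm _ _).trans (by simp)
    · refine ⟨2, by linarith, fun R => ?_⟩
      have h2 : ContDiff ℝ 2 u := hc.of_le (by exact_mod_cast hm)
      obtain ⟨C, hC0, hC⟩ := exists_abs_deriv_sub_le (f := u) (-(R + 1)) (R + 1)
        (fun y _ => h2.contDiffAt)
      refine ⟨C * 2 ^ (1 : ℝ), by positivity, fun x hx z hz => ?_⟩
      have hx' := abs_le.1 hx
      have := abs_secondDiff_le (f := u) (x := x) (z := z) (θ := 1) zero_le_one hC0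
        (fun y _ => h2.differentiable (by simp) y) (fun a ha b hb => by
          rw [Real.rpow_one]
          exact hC a ⟨by linarith [ha.1, hx'.1], by linarith [ha.2, hx'.2]⟩ b
            ⟨by linarith [hb.1, hx'.1], by linarith [hb.2, hx'.2]⟩)
      norm_num at this ⊢
      exact this
  obtain ⟨p, hp, h⟩ := hsuff
  refine ⟨p, hp, fun R => ?_⟩
  obtain ⟨C, hC0, hC⟩ := h R
  refine ⟨C + 4, by positivity, fun x hx z => ?_⟩
  rcases le_total |z| 1 with hz | hz
  · rw [min_eq_right (Real.rpow_le_one (abs_nonneg z) hz (by linarith))]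
    refine (hC x hx z hz).trans ?_
    gcongr; linarith
  · rw [min_eq_left (Real.one_le_rpow hz (by linarith))]
    have h1 := abs_le.1 (hb (x + z))
    have h2 := abs_le.1 (hb (x - z))
    have h3 := abs_le.1 (hb x)
    rw [secondDiff, abs_le]
    constructor <;> linarith [h1.1, h1.2, h2.1, h2.2, h3.1, h3.2]

/-- The barrier, equal to `|x| ^ (-1 - 2 * s)` outside `(-ρ, ρ)` and constant inside. -/
def barrier (s ρ x : ℝ) : ℝ := (max ρ |x|) ^ (-1 - 2 * s)

lemma continuous_barrier {s ρ : ℝ} (hρ : 0 < ρ) : Continuous (barrier s ρ) := by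
  unfold barrier
  refine Continuous.rpow_const (by fun_prop) fun x => Or.inl ?_
  exact (lt_max_of_lt_left hρ).ne'

lemma barrier_nonneg {s ρ : ℝ} (hρ : 0 < ρ) (x : ℝ) : 0 ≤ barrier s ρ x :=
  Real.rpow_nonneg (le_max_of_le_left hρ.le) _

lemma barrier_of_le {s ρ x : ℝ} (hx : ρ ≤ |x|) : barrier s ρ x = |x| ^ (-1 - 2 * s) := by
  rw [barrier, max_eq_right hx]

lemma barrier_eq_scale {s ρ : ℝ} (hρ : 0 < ρ) (x : ℝ) :
    barrier s ρ x = ρ ^ (-1 - 2 * s) * barrier s 1 (x / ρ) := by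
  rw [barrier, barrier, ← Real.mul_rpow hρ.le (by positivity), abs_div, abs_of_pos hρ,
    mul_max_of_nonneg _ _ hρ.le, mul_one, mul_div_cancel₀ _ hρ.ne']

lemma integrable_barrier {s ρ : ℝ} (hs0 : 0 < s) (hρ : 0 < ρ) : Integrable (barrier s ρ) := by
  have h1 : Integrable (barrier s 1) := by
    refine (integrable_min_one_rpow_mul (p := 1 + 2 * s) hs0 (by linarith)).congr ?_
    filter_upwards [compl_mem_ae_iff.2 (measure_singleton (0 : ℝ))] with x hx
    have hx : 0 < |x| := abs_pos.2 hx
    rw [barrier]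
    rcases le_total |x| 1 with h | h
    · rw [max_eq_left h, min_eq_right (Real.rpow_le_one hx.le h (by linarith)),
        ← Real.rpow_add hx, Real.one_rpow]
      ring_nf; simp
    · rw [max_eq_right h, min_eq_left (Real.one_le_rpow h (by linarith)), one_mul]
  refine ((h1.comp_div hρ.ne').const_mul (ρ ^ (-1 - 2 * s))).congr ?_
  exact Eventually.of_forall fun x => (barrier_eq_scale hρ x).symm

lemma rpow_mul_self {s x : ℝ} (hx : 0 < x) : x ^ (-1 - 2 * s) * x = x ^ (-(2 * s)) := by
  rw [← Real.rpow_add_one hx.ne']; ring_nf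

lemma integral_barrier {s ρ : ℝ} (hρ : 0 < ρ) :
    ∫ x, barrier s ρ x = ρ ^ (-(2 * s)) * ∫ x, barrier s 1 x := by
  simp_rw [barrier_eq_scale hρ]
  rw [integral_const_mul, Measure.integral_comp_div (barrier s 1) ρ, abs_of_pos hρ, smul_eq_mul,
    ← mul_assoc, rpow_mul_self hρ]

lemma exists_abs_secondDiff_rpow_le (q : ℝ) :
    ∃ C, 0 ≤ C ∧ ∀ t, |t| ≤ 1 / 2 → |secondDiff (fun y : ℝ => y ^ q) 1 t| ≤ C * |t| ^ (2 : ℝ) := by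
  have hd : ∀ y ∈ Icc (1 / 2 : ℝ) (3 / 2), ContDiffAt ℝ 2 (fun y : ℝ => y ^ q) y := fun y hy =>
    Real.contDiffAt_rpow_const_of_ne (by linarith [hy.1])
  obtain ⟨C, hC0, hC⟩ := exists_abs_deriv_sub_le (1 / 2 : ℝ) (3 / 2) hd
  refine ⟨C * 2 ^ (1 : ℝ), by positivity, fun t ht => ?_⟩
  have hsub : ∀ y ∈ Icc (1 - |t|) (1 + |t|), y ∈ Icc (1 / 2 : ℝ) (3 / 2) := fun y hy =>
    ⟨by linarith [hy.1], by linarith [hy.2]⟩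
  have := abs_secondDiff_le (f := fun y : ℝ => y ^ q) (x := 1) (z := t) (θ := 1) zero_le_one hC0
    (fun y hy => (hd y (hsub y hy)).differentiableAt (by simp)) (fun a ha b hb => by
      rw [Real.rpow_one]; exact hC a (hsub a ha) b (hsub b hb))
  norm_num at this ⊢
  exact this

lemma exists_secondDiff_barrier_le {s : ℝ} (hs0 : 0 < s) (hs1 : s < 1) :
    ∃ A, 0 < A ∧ ∀ ρ, 0 < ρ → ∀ x, 2 * ρ ≤ |x| → ∃ B : ℝ → ℝ, Integrable B ∧
      ∫ z, B z ≤ A * ρ ^ (-(2 * s)) * |x| ^ (-1 - 2 * s) ∧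
      ∀ z, z ≠ 0 → ∀ k, 0 ≤ k → k ≤ |z| ^ (-1 - 2 * s) →
        secondDiff (barrier s ρ) x z * k ≤ B z := by
  obtain ⟨C, hC0, hC⟩ := exists_abs_secondDiff_rpow_le (-1 - 2 * s)
  set h : ℝ → ℝ := fun z => min 1 (|z| ^ (2 : ℝ)) * |z| ^ (-1 - 2 * s) with hh
  have hint : Integrable h := integrable_min_one_rpow_mul hs0 (by linarith)
  have hnn : ∀ z, 0 ≤ h z := fun z => by positivity
  set I := ∫ z, h z
  set I' := ∫ z, barrier s 1 z
  have hI : 0 ≤ I := integral_nonneg hnn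
  have hI' : 0 ≤ I' := integral_nonneg (barrier_nonneg one_pos)
  refine ⟨C * I + (1 / 2 : ℝ) ^ (-1 - 2 * s) * (2 * I') + 1, by positivity, fun ρ hρ x hx => ?_⟩
  have hx0 : 0 < |x| := by linarith
  have hx0' : x ≠ 0 := abs_pos.1 hx0
  have hb := integrable_barrier hs0 hρ
  have i1 : Integrable (fun z => C * |x| ^ (-1 - 2 * s) * (|x| ^ (-1 - 2 * s) * h (z / x))) :=
    ((hint.comp_div hx0').const_mul _).const_mul _
  have i2 : Integrable (fun z => (|x| * (1 / 2)) ^ (-1 - 2 * s) *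
      (barrier s ρ (x + z) + barrier s ρ (x - z))) :=
    ((hb.comp_add_left x).add (hb.comp_sub_left x)).const_mul _
  refine ⟨_, i1.add i2, ?_, ?_⟩
  · rw [Pi.add_def, integral_add i1 i2, integral_const_mul, integral_const_mul, integral_const_mul,
      integral_add (hb.comp_add_left x) (hb.comp_sub_left x), Measure.integral_comp_div h x,
      integral_add_left_eq_self, integral_sub_left_eq_self, integral_barrier hρ, smul_eq_mul,
      ← mul_assoc _ |x|, rpow_mul_self hx0, Real.mul_rpow hx0.le (by norm_num)]
    have : |x| ^ (-(2 * s)) ≤ ρ ^ (-(2 * s)) :=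
      Real.rpow_le_rpow_of_nonpos hρ (by linarith) (by linarith)
    have h1 : C * |x| ^ (-1 - 2 * s) * (|x| ^ (-(2 * s)) * I) ≤
      C * |x| ^ (-1 - 2 * s) * (ρ ^ (-(2 * s)) * I) := by gcongr
    have h2 : 0 ≤ ρ ^ (-(2 * s)) * |x| ^ (-1 - 2 * s) := by positivity
    change C * |x| ^ (-1 - 2 * s) * (|x| ^ (-(2 * s)) * I) + |x| ^ (-1 - 2 * s) *
      (1 / 2) ^ (-1 - 2 * s) * (ρ ^ (-(2 * s)) * I' + ρ ^ (-(2 * s)) * I') ≤ _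
    linarith
  · intro z hz k hk hk'
    have hp1 : 0 ≤ C * |x| ^ (-1 - 2 * s) * (|x| ^ (-1 - 2 * s) * h (z / x)) := by
      have := hnn (z / x); positivity
    have hp2 : 0 ≤ (|x| * (1 / 2)) ^ (-1 - 2 * s) *
        (barrier s ρ (x + z) + barrier s ρ (x - z)) := by
      have h1 := barrier_nonneg (s := s) hρ (x + z)
      have h2 := barrier_nonneg (s := s) hρ (x - z)
      positivity
    have hz0 : 0 < |z| := abs_pos.2 hz
    simp only [Pi.add_apply]
    rcases le_total |z| (|x| * (1 / 2)) with hzx | hzx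
    · refine le_add_of_le_of_nonneg ?_ hp2
      have ht : |z / x| ≤ 1 / 2 := by rw [abs_div, div_le_iff₀ hx0]; linarith
      have ht' := abs_le.1 ht
      have e1 : |x + z| = |x| * (1 + z / x) := by
        rw [← abs_of_nonneg (a := 1 + z / x) (by linarith), ← abs_mul]; congr 1; field_simp
      have e2 : |x - z| = |x| * (1 - z / x) := by
        rw [← abs_of_nonneg (a := 1 - z / x) (by linarith), ← abs_mul]; congr 1; field_simp
      have hD : secondDiff (barrier s ρ) x z =
          |x| ^ (-1 - 2 * s) * secondDiff (fun y : ℝ => y ^ (-1 - 2 * s)) 1 (z / x) := by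
        rw [secondDiff, secondDiff, barrier_of_le (x := x) (by linarith),
          barrier_of_le (x := x + z), barrier_of_le (x := x - z),
          e1, e2, Real.mul_rpow hx0.le (by linarith), Real.mul_rpow hx0.le (by linarith),
          Real.one_rpow]
        · ring
        · rw [e2]; nlinarith
        · rw [e1]; nlinarith
      have hzz : |x| ^ (-1 - 2 * s) * h (z / x) = |z / x| ^ (2 : ℝ) * |z| ^ (-1 - 2 * s) := by
        have h1 : |z / x| ^ (2 : ℝ) ≤ 1 := Real.rpow_le_one (abs_nonneg _) (by linarith) (by norm_num)
        simp only [hh]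
        rw [min_eq_right h1]
        nth_rewrite 2 [abs_div]
        rw [mul_left_comm, ← Real.mul_rpow hx0.le (by positivity), mul_div_cancel₀ _ hx0.ne']
      rw [hD, hzz]
      have := (le_abs_self _).trans (hC _ ht)
      have h0 : 0 ≤ C * |z / x| ^ (2 : ℝ) := by positivity
      calc _ ≤ |x| ^ (-1 - 2 * s) * (C * |z / x| ^ (2 : ℝ)) * k := by gcongr
        _ ≤ |x| ^ (-1 - 2 * s) * (C * |z / x| ^ (2 : ℝ)) * |z| ^ (-1 - 2 * s) := by gcongr
        _ = _ := by ring
    · refine le_add_of_nonneg_of_le hp1 ?_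
      have h1 := barrier_nonneg (s := s) hρ (x + z)
      have h2 := barrier_nonneg (s := s) hρ (x - z)
      have h3 := barrier_nonneg (s := s) hρ x
      have hk2 : k ≤ (|x| * (1 / 2)) ^ (-1 - 2 * s) := hk'.trans
        (Real.rpow_le_rpow_of_nonpos (by linarith) hzx (by linarith))
      calc _ ≤ (barrier s ρ (x + z) + barrier s ρ (x - z)) * k := by
            gcongr; rw [secondDiff]; linarith
        _ ≤ (barrier s ρ (x + z) + barrier s ρ (x - z)) * (|x| * (1 / 2)) ^ (-1 - 2 * s) := by gcongr
        _ = _ := mul_comm _ _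

lemma exists_mul_sub_le_deriv_sub {W : ℝ → ℝ} (hW : ContDiff ℝ 2 W) {a : ℝ}
    (ha : 0 < deriv (deriv W) a) :
    ∃ c, 0 < c ∧ ∃ U ∈ 𝓝 a, ∀ r ∈ U, ∀ r' ∈ U, r ≤ r' →
      c * (r' - r) ≤ deriv W r' - deriv W r := by
  have h1 : ContDiff ℝ 1 (deriv W) := ContDiff.deriv' hW
  have h2 : Continuous (deriv (deriv W)) := h1.continuous_deriv le_rfl
  obtain ⟨ε, hε, hball⟩ := Metric.mem_nhds_iff.1 (h2.continuousAt.eventually_const_lt (half_lt_self ha))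
  refine ⟨deriv (deriv W) a / 2, by positivity, Metric.ball a ε, Metric.ball_mem_nhds a hε,
    fun r hr r' hr' hrr => ?_⟩
  exact (convex_ball a ε).mul_sub_le_image_sub_of_le_deriv h1.continuous.continuousOn
    (h1.differentiable one_ne_zero).differentiableOn
    (fun y hy => (hball (interior_subset hy)).le) r hr r' hr' hrr

lemma exists_mul_sub_le_deriv_comp_sub {W u : ℝ → ℝ} (hW : ContDiff ℝ 2 W)
    (h1 : 0 < deriv (deriv W) 1) (h2 : 0 < deriv (deriv W) (-1)) (hmono : Monotone u)
    (htop : Tendsto u atTop (𝓝 1)) (hbot : Tendsto u atBot (𝓝 (-1))) :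
    ∃ c, 0 < c ∧ ∃ R, 0 < R ∧ ∀ x h, R ≤ |x| → 0 ≤ h → h ≤ 1 →
      c * (u (x + h) - u x) ≤ deriv W (u (x + h)) - deriv W (u x) := by
  obtain ⟨c₁, hc₁, U₁, hU₁, H₁⟩ := exists_mul_sub_le_deriv_sub hW h1
  obtain ⟨c₂, hc₂, U₂, hU₂, H₂⟩ := exists_mul_sub_le_deriv_sub hW h2
  obtain ⟨a, ha⟩ := eventually_atTop.1 (htop.eventually_mem hU₁)
  obtain ⟨b, hb⟩ := eventually_atBot.1 (hbot.eventually_mem hU₂)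
  refine ⟨min c₁ c₂, lt_min hc₁ hc₂, |a| + |b| + 1, by positivity, fun x h hx hh0 hh1 => ?_⟩
  have hu : 0 ≤ u (x + h) - u x := sub_nonneg.2 (hmono (by linarith))
  have ha' := le_abs_self a
  have hb' := neg_abs_le b
  have ha'' := abs_nonneg a
  have hb'' := abs_nonneg b
  rcases le_abs.1 hx with hx | hx
  · exact (mul_le_mul_of_nonneg_right (min_le_left _ _) hu).trans
      (H₁ _ (ha _ (by linarith)) _ (ha _ (by linarith)) (sub_nonneg.1 hu))
  · exact (mul_le_mul_of_nonneg_right (min_le_right _ _) hu).trans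
      (H₂ _ (hb _ (by linarith)) _ (hb _ (by linarith)) (sub_nonneg.1 hu))

lemma increment_le_barrier {J u g : ℝ → ℝ} {s Lam A c ρ M h p : ℝ} (hs0 : 0 < s)
    (hLam : 0 < Lam) (hJ : KernelBound J s Lam) (hu : Continuous u)
    (htop : Tendsto u atTop (𝓝 1)) (hbot : Tendsto u atBot (𝓝 (-1)))
    (hp : 2 * s < p) (hD : ∀ R, ∃ C, 0 ≤ C ∧ ∀ x, |x| ≤ R → ∀ z,
      |secondDiff u x z| ≤ C * min 1 (|z| ^ p))
    (heq : ∀ x, opLK volume J u x = g x)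
    (hρ : 0 < ρ) (hM : 0 ≤ M)
    (hA : ∀ x, 2 * ρ ≤ |x| → ∃ B : ℝ → ℝ, Integrable B ∧
      ∫ z, B z ≤ A * ρ ^ (-(2 * s)) * |x| ^ (-1 - 2 * s) ∧
      ∀ z, z ≠ 0 → ∀ k, 0 ≤ k → k ≤ |z| ^ (-1 - 2 * s) →
        secondDiff (barrier s ρ) x z * k ≤ B z)
    (hc : 0 < c) (hAc : Lam * (A * ρ ^ (-(2 * s))) ≤ 2 * c)
    (hg : ∀ x, 2 * ρ ≤ |x| → c * (u (x + h) - u x) ≤ g (x + h) - g x)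
    (hin : ∀ x, |x| ≤ 2 * ρ → u (x + h) - u x ≤ M * barrier s ρ x) (x : ℝ) :
    u (x + h) - u x ≤ M * barrier s ρ x := by
  by_contra! hx
  have hcont : Continuous fun x => M * barrier s ρ x - (u (x + h) - u x) := by
    have := continuous_barrier (s := s) hρ
    fun_prop
  obtain ⟨x₀, hx₀⟩ := hcont.exists_forall_le' x (by
    have hlim : ∀ᶠ y in cocompact ℝ, u (y + h) - u y < u (x + h) - u x - M * barrier s ρ x := by
      rw [cocompact_eq_atBot_atTop, eventually_sup]
      constructor
      · have := (hbot.comp (tendsto_atBot_add_const_right _ h tendsto_id)).sub hbot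
        rw [sub_self] at this
        exact this.eventually_lt_const (by linarith)
      · have := (htop.comp (tendsto_atTop_add_const_right _ h tendsto_id)).sub htop
        rw [sub_self] at this
        exact this.eventually_lt_const (by linarith)
    filter_upwards [hlim] with y hy
    have := mul_nonneg hM (barrier_nonneg (s := s) hρ y)
    linarith)
  have hneg : M * barrier s ρ x₀ < u (x₀ + h) - u x₀ := by have := hx₀ x; linarith
  have hxρ : 2 * ρ ≤ |x₀| := by
    by_contra! hlt
    exact absurd (hin x₀ hlt.le) (not_le.2 hneg)
  obtain ⟨B, hBint, hB, hBle⟩ := hA x₀ hxρ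
  have hmeas : ∀ y, Measurable (secondDiff u y) := fun y => by
    unfold secondDiff; exact Continuous.measurable (by fun_prop)
  have hint : ∀ y, Integrable fun z => secondDiff u y z * J z := fun y => by
    obtain ⟨C, -, hC⟩ := hD |y|
    exact hJ.integrable_mul hs0 hp (hmeas y) (hC y le_rfl)
  have hval : ∀ y, ∫ z, secondDiff u y z * J z = 2 * g y := fun y => by
    rw [← heq y, opLK]; simp only [secondDiff]; ring
  have hle : ∫ z, (secondDiff u (x₀ + h) z * J z - secondDiff u x₀ z * J z) ≤
      ∫ z, M * Lam * B z := by
    refine integral_mono_ae ((hint _).sub (hint _)) (hBint.const_mul _) ?_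
    filter_upwards [hJ.le, compl_mem_ae_iff.2 (measure_singleton (0 : ℝ))] with z hz hz0
    have h1 := hBle z hz0 (J z / Lam) (div_nonneg (hJ.nonneg z) hLam.le)
      (by rw [div_le_iff₀ hLam]; linarith)
    have h2 : secondDiff u (x₀ + h) z - secondDiff u x₀ z ≤ M * secondDiff (barrier s ρ) x₀ z := by
      have e1 := hx₀ (x₀ + z)
      have e2 := hx₀ (x₀ - z)
      simp only [secondDiff]
      rw [add_right_comm x₀ h z, add_sub_right_comm x₀ h z]
      linarith
    calc _ = (secondDiff u (x₀ + h) z - secondDiff u x₀ z) * J z := by ring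
      _ ≤ M * secondDiff (barrier s ρ) x₀ z * J z := by gcongr; exact hJ.nonneg z
      _ = M * Lam * (secondDiff (barrier s ρ) x₀ z * (J z / Lam)) := by field_simp
      _ ≤ _ := by gcongr
  rw [integral_sub (hint _) (hint _), hval, hval, integral_const_mul] at hle
  have h1 := hg x₀ hxρ
  have hb : barrier s ρ x₀ = |x₀| ^ (-1 - 2 * s) := barrier_of_le (by linarith)
  have h2 : M * Lam * ∫ z, B z ≤ 2 * c * (M * barrier s ρ x₀) := by
    calc _ ≤ M * Lam * (A * ρ ^ (-(2 * s)) * |x₀| ^ (-1 - 2 * s)) := by gcongr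
      _ = Lam * (A * ρ ^ (-(2 * s))) * (M * barrier s ρ x₀) := by rw [hb]; ring
      _ ≤ _ := by have := barrier_nonneg (s := s) hρ x₀; gcongr
  nlinarith

lemma exists_deriv_le_of_opLK_eq {J W u : ℝ → ℝ} {s Lam p : ℝ} (hs0 : 0 < s) (hs1 : s < 1)
    (hLam : 0 < Lam) (hJ : KernelBound J s Lam) (hW : ContDiff ℝ 2 W)
    (hW1 : 0 < deriv (deriv W) 1) (hW2 : 0 < deriv (deriv W) (-1))
    (hu : ContDiff ℝ 1 u) (hmono : Monotone u)
    (htop : Tendsto u atTop (𝓝 1)) (hbot : Tendsto u atBot (𝓝 (-1)))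
    (hp : 2 * s < p) (hD : ∀ R, ∃ C, 0 ≤ C ∧ ∀ x, |x| ≤ R → ∀ z,
      |secondDiff u x z| ≤ C * min 1 (|z| ^ p))
    (heq : ∀ x, opLK volume J u x = deriv W (u x)) :
    ∃ C, 0 ≤ C ∧ ∃ R, 0 < R ∧ ∀ x, R ≤ |x| → deriv u x ≤ C * |x| ^ (-1 - 2 * s) := by
  obtain ⟨c, hc, R, hR, hcR⟩ := exists_mul_sub_le_deriv_comp_sub hW hW1 hW2 hmono htop hbot
  obtain ⟨A, hA0, hA⟩ := exists_secondDiff_barrier_le hs0 hs1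
  obtain ⟨ρ, hρ, hρR, hρc⟩ : ∃ ρ, 0 < ρ ∧ R ≤ 2 * ρ ∧ Lam * (A * ρ ^ (-(2 * s))) ≤ 2 * c := by
    have hlim : Tendsto (fun ρ : ℝ => Lam * (A * ρ ^ (-(2 * s)))) atTop (𝓝 0) := by
      simpa using ((tendsto_rpow_neg_atTop (y := 2 * s) (by linarith)).const_mul A).const_mul Lam
    obtain ⟨ρ, h1, h2, h3⟩ := ((eventually_gt_atTop 0).and ((eventually_ge_atTop R).and
      (hlim.eventually_le_const (u := 2 * c) (by linarith)))).exists
    exact ⟨ρ, h1, by linarith, h3⟩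
  have hdiff : Differentiable ℝ u := hu.differentiable one_ne_zero
  obtain ⟨S, hS⟩ := isCompact_Icc.exists_bound_of_continuousOn (s := Icc (-(2 * ρ)) (2 * ρ + 1))
    (hu.continuous_deriv le_rfl).continuousOn
  have hkey : ∀ h, 0 < h → h ≤ 1 → ∀ x,
      u (x + h) - u x ≤ |S| * h * (2 * ρ) ^ (1 + 2 * s) * barrier s ρ x := by
    intro h hh hh1
    refine increment_le_barrier hs0 hLam hJ hu.continuous htop hbot hp hD heq hρ
      (by positivity) (hA ρ hρ) hc hρc (fun x hx => hcR x h (hρR.trans hx) hh.le hh1) ?_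
    intro x hx
    have hx' := abs_le.1 hx
    have h1 := (convex_Icc (-(2 * ρ)) (2 * ρ + 1)).norm_image_sub_le_of_norm_deriv_le
      (C := |S|) (fun z _ => hdiff z) (fun z hz => (hS z hz).trans (le_abs_self S))
      (x := x) (y := x + h) ⟨by linarith, by linarith⟩ ⟨by linarith, by linarith⟩
    rw [add_sub_cancel_left, Real.norm_of_nonneg hh.le] at h1
    have h2 : (2 * ρ) ^ (-1 - 2 * s) ≤ barrier s ρ x :=
      Real.rpow_le_rpow_of_nonpos (by positivity) (max_le (by linarith) hx) (by linarith)
    have h3 : (2 * ρ) ^ (1 + 2 * s) * (2 * ρ) ^ (-1 - 2 * s) = 1 := by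
      rw [← Real.rpow_add (by positivity)]; ring_nf; simp
    calc _ ≤ |S| * h := (le_abs_self _).trans h1
      _ = |S| * h * (2 * ρ) ^ (1 + 2 * s) * (2 * ρ) ^ (-1 - 2 * s) := by rw [mul_assoc, h3, mul_one]
      _ ≤ _ := by gcongr
  refine ⟨|S| * (2 * ρ) ^ (1 + 2 * s), by positivity, 2 * ρ, by positivity, fun x hx => ?_⟩
  have hslope := (hdiff x).hasDerivAt.tendsto_slope_zero_right
  refine le_of_tendsto hslope ?_
  filter_upwards [Ioc_mem_nhdsGT one_pos] with h hh
  have h1 := hkey h hh.1 hh.2 x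
  rw [barrier_of_le (by linarith)] at h1
  rw [smul_eq_mul, inv_mul_le_iff₀ hh.1]
  linarith

lemma exists_one_sub_le_of_deriv_le {u : ℝ → ℝ} {s C R : ℝ} (hs0 : 0 < s) (hR : 0 < R)
    (hu : Differentiable ℝ u) (htop : Tendsto u atTop (𝓝 1))
    (hd : ∀ x, R ≤ x → deriv u x ≤ C * x ^ (-1 - 2 * s)) (x : ℝ) (hx : R ≤ x) :
    1 - u x ≤ C / (2 * s) * x ^ (-(2 * s)) := by
  have hderiv : ∀ y, R ≤ y → HasDerivAt (fun y => u y + C / (2 * s) * y ^ (-(2 * s)))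
      (deriv u y - C * y ^ (-1 - 2 * s)) y := by
    intro y hy
    have h1 := (Real.hasDerivAt_rpow_const (x := y) (p := -(2 * s))
      (Or.inl (by linarith))).const_mul (C / (2 * s))
    refine ((hu y).hasDerivAt.add h1).congr_deriv ?_
    rw [show -(2 * s) - 1 = -1 - 2 * s by ring]
    field_simp
    ring
  have hanti : AntitoneOn (fun y => u y + C / (2 * s) * y ^ (-(2 * s))) (Ici R) := by
    refine antitoneOn_of_deriv_nonpos (convex_Ici R)
      (fun y hy => (hderiv y hy).continuousAt.continuousWithinAt)
      (fun y hy => (hderiv y (interior_subset hy)).differentiableAt.differentiableWithinAt)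
      fun y hy => ?_
    rw [(hderiv y (interior_subset hy)).deriv]
    linarith [hd y (interior_subset hy)]
  have hlim : Tendsto (fun y => u y + C / (2 * s) * y ^ (-(2 * s))) atTop (𝓝 1) := by
    simpa using htop.add
      ((tendsto_rpow_neg_atTop (y := 2 * s) (by linarith)).const_mul (C / (2 * s)))
  have := le_of_tendsto hlim (by
    filter_upwards [eventually_ge_atTop x] with y hy
    exact hanti hx (hx.trans hy) hy)
  linarith

/-- The change of variables `(x, z) ↦ (x + z, x)`, under which the difference of the two
coordinates becomes `z`. -/
def incrementEquiv : ℝ × ℝ ≃ᵐ ℝ × ℝ :=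
  (MeasurableEquiv.shearAddRight ℝ).trans MeasurableEquiv.prodComm

lemma incrementEquiv_apply (q : ℝ × ℝ) : incrementEquiv q = (q.1 + q.2, q.1) := rfl

lemma measurePreserving_incrementEquiv :
    MeasurePreserving incrementEquiv ((volume : Measure ℝ).prod volume)
      ((volume : Measure ℝ).prod volume) :=
  Measure.measurePreserving_swap.comp (measurePreserving_prod_add volume volume)

lemma integrable_sq_sub_mul_kernel {J φ : ℝ → ℝ} {s Lam : ℝ} (hs0 : 0 < s) (hs1 : s < 1)
    (hJ : KernelBound J s Lam) (hφ : ContDiff ℝ 1 φ) (hsupp : HasCompactSupport φ) :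
    Integrable (fun p : ℝ × ℝ => (φ p.1 - φ p.2) ^ 2 * J (p.1 - p.2))
      ((volume : Measure ℝ).prod volume) := by
  rw [← measurePreserving_incrementEquiv.integrable_comp_emb incrementEquiv.measurableEmbedding]
  obtain ⟨L, hL⟩ := hφ.lipschitzWith_of_hasCompactSupport hsupp one_ne_zero
  obtain ⟨M, hM⟩ := hsupp.exists_bound_of_continuous hφ.continuous
  have hM0 : 0 ≤ M := (norm_nonneg _).trans (hM 0)
  have hJm := hJ.meas
  have hφm := hφ.continuous.measurable
  set B := tsupport φ
  have hB : MeasurableSet B := (isClosed_tsupport φ).measurableSet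
  have hBi : Integrable (B.indicator (fun _ => (1 : ℝ))) :=
    (integrable_indicator_iff hB).2 (integrableOn_const hsupp.measure_lt_top.ne)
  have hk := hJ.integrable_min hs0 (p := 2) (by linarith)
  have i1 := hBi.mul_prod hk
  have i2 := (measurePreserving_add_prod (volume : Measure ℝ) (volume : Measure ℝ)).integrable_comp
    i1.aestronglyMeasurable |>.2 i1
  refine ((i1.add i2).const_mul (4 * M ^ 2 + L ^ 2)).mono' ?_ (Eventually.of_forall fun q => ?_)
  · refine Measurable.aestronglyMeasurable ?_
    simp only [Function.comp_def, incrementEquiv_apply]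
    fun_prop
  · obtain ⟨x, z⟩ := q
    have hsq : (φ (x + z) - φ x) ^ 2 ≤ (4 * M ^ 2 + L ^ 2) * min 1 (|z| ^ (2 : ℝ)) := by
      have h1 := abs_le.1 (hM (x + z))
      have h2 := abs_le.1 (hM x)
      have h3 := hL.dist_le_mul (x + z) x
      rw [Real.dist_eq, Real.dist_eq, add_sub_cancel_left] at h3
      have h4 : (φ (x + z) - φ x) ^ 2 ≤ L ^ 2 * |z| ^ 2 := by
        rw [← mul_pow, ← sq_abs]; gcongr
      have h5 : (φ (x + z) - φ x) ^ 2 ≤ 4 * M ^ 2 := by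
        rw [show 4 * M ^ 2 = (2 * M) ^ 2 by ring]
        exact sq_le_sq' (by linarith) (by linarith)
      have h6 : |z| ^ (2 : ℝ) = |z| ^ 2 := by norm_cast
      rw [h6]
      rcases min_choice 1 (|z| ^ 2) with h | h <;> rw [h]
      · nlinarith [sq_nonneg (L : ℝ)]
      · nlinarith [mul_nonneg (sq_nonneg M) (sq_nonneg |z|)]
    have h0 : 0 ≤ min 1 (|z| ^ (2 : ℝ)) := by positivity
    have hJ0 := hJ.nonneg z
    have hC : 0 ≤ 4 * M ^ 2 + (L : ℝ) ^ 2 := by positivity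
    simp only [Function.comp_apply, incrementEquiv_apply, Pi.add_apply, add_sub_cancel_left]
    rw [Real.norm_of_nonneg (by positivity)]
    by_cases hx : x ∈ B <;> by_cases hxz : x + z ∈ B
    · rw [indicator_of_mem hx, indicator_of_mem hxz]
      nlinarith [mul_le_mul_of_nonneg_right hsq hJ0, mul_nonneg hC (mul_nonneg h0 hJ0)]
    · rw [indicator_of_mem hx, indicator_of_notMem hxz]
      nlinarith [mul_le_mul_of_nonneg_right hsq hJ0, mul_nonneg hC (mul_nonneg h0 hJ0)]
    · rw [indicator_of_notMem hx, indicator_of_mem hxz]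
      nlinarith [mul_le_mul_of_nonneg_right hsq hJ0, mul_nonneg hC (mul_nonneg h0 hJ0)]
    · rw [image_eq_zero_of_notMem_tsupport hx, image_eq_zero_of_notMem_tsupport hxz,
        indicator_of_notMem hx, indicator_of_notMem hxz]
      simp

lemma hasDerivAt_integral_potential {W u φ : ℝ → ℝ} (hW : ContDiff ℝ 2 W) (hu : Continuous u)
    (hub : ∀ x, |u x| ≤ 1) (hφ : Continuous φ) (hsupp : HasCompactSupport φ) (R : ℝ) :
    HasDerivAt (fun t => ∫ x in Ioo (-R) R, W (u x + t * φ x))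
      (∫ x in Ioo (-R) R, deriv W (u x) * φ x) 0 := by
  obtain ⟨M, hM⟩ := hsupp.exists_bound_of_continuous hφ
  have hM0 : 0 ≤ M := (norm_nonneg _).trans (hM 0)
  have hW' : Continuous (deriv W) := hW.continuous_deriv (by norm_num)
  have hWc := hW.continuous
  obtain ⟨S, hS⟩ := (isCompact_Icc (a := -(1 + M)) (b := 1 + M)).exists_bound_of_continuousOn
    hW'.continuousOn
  have hS0 : 0 ≤ S := (norm_nonneg _).trans (hS 0 ⟨by linarith, by linarith⟩)
  have := (hasDerivAt_integral_of_dominated_loc_of_deriv_le (μ := volume.restrict (Ioo (-R) R))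
    (F := fun t x => W (u x + t * φ x)) (F' := fun t x => deriv W (u x + t * φ x) * φ x)
    (x₀ := (0 : ℝ)) (bound := fun _ => S * M) (Metric.ball_mem_nhds 0 one_pos)
    (Eventually.of_forall fun t => Continuous.aestronglyMeasurable (by fun_prop))
    ((Continuous.integrableOn_Icc (by fun_prop)).mono_set Ioo_subset_Icc_self)
    (Continuous.aestronglyMeasurable (by fun_prop))
    (Eventually.of_forall fun x t ht => ?_) (integrableOn_const (by simp))
    (Eventually.of_forall fun x t _ => ?_)).2
  · simpa using this
  · have ht : |t| ≤ 1 := by simpa using (Metric.mem_ball.1 ht).le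
    rw [norm_mul]
    refine mul_le_mul (hS _ ?_) (hM x) (norm_nonneg _) hS0
    have h1 : |t * φ x| ≤ 1 * M := by
      rw [abs_mul]
      exact mul_le_mul ht (hM x) (abs_nonneg _) one_pos.le
    have h2 := abs_le.1 h1
    have h3 := abs_le.1 (hub x)
    exact ⟨by linarith, by linarith⟩
  · have h1 := (hW.differentiable (by norm_num) (u x + t * φ x)).hasDerivAt
    have h2 : HasDerivAt (fun t => u x + t * φ x) (φ x) t := by
      simpa using ((hasDerivAt_id t).mul_const (φ x)).const_add (u x)
    exact h1.comp t h2

lemma nlEnergy_eq_ofReal {K W v : ℝ → ℝ} {Ω : Set ℝ} (hW : ∀ r, 0 ≤ W r)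
    (h1 : IntegrableOn (fun p : ℝ × ℝ => (v p.1 - v p.2) ^ 2 * max (K (p.1 - p.2)) 0)
      (Ωᶜ ×ˢ Ωᶜ)ᶜ (volume.prod volume))
    (h2 : IntegrableOn (fun x => W (v x)) Ω) :
    nlEnergy volume K W v Ω = ENNReal.ofReal (
      1 / 4 * ∫ p in (Ωᶜ ×ˢ Ωᶜ)ᶜ, (v p.1 - v p.2) ^ 2 * max (K (p.1 - p.2)) 0 ∂(volume.prod volume)
      + ∫ x in Ω, W (v x)) := by
  have hK : ∀ a b : ℝ, ENNReal.ofReal (a ^ 2 * b) = ENNReal.ofReal (a ^ 2 * max b 0) := by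
    intro a b
    rcases le_total 0 b with hb | hb
    · rw [max_eq_left hb]
    · rw [max_eq_right hb, ENNReal.ofReal_of_nonpos (mul_nonpos_of_nonneg_of_nonpos (sq_nonneg a) hb)]
      simp
  have hnn : ∀ p : ℝ × ℝ, 0 ≤ (v p.1 - v p.2) ^ 2 * max (K (p.1 - p.2)) 0 := fun p => by positivity
  rw [nlEnergy, ENNReal.ofReal_add (mul_nonneg (by norm_num) (integral_nonneg hnn))
    (integral_nonneg fun x => hW _), ENNReal.ofReal_mul (by norm_num),
    ofReal_integral_eq_lintegral_ofReal h1 (Eventually.of_forall hnn),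
    ofReal_integral_eq_lintegral_ofReal h2 (Eventually.of_forall fun x => hW _)]
  rw [lintegral_congr fun p : ℝ × ℝ => hK (v p.1 - v p.2) (K (p.1 - p.2)),
    ENNReal.ofReal_div_of_pos (by norm_num)]
  simp

lemma integrable_energy_of_isLocalMinimizer {K W u : ℝ → ℝ} {Ω : Set ℝ} (hK : Measurable K)
    (hu : Measurable u) (hmin : IsLocalMinimizer volume K W u Ω) :
    IntegrableOn (fun p : ℝ × ℝ => (u p.1 - u p.2) ^ 2 * max (K (p.1 - p.2)) 0)
      (Ωᶜ ×ˢ Ωᶜ)ᶜ (volume.prod volume) := by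
  have hfin := (ENNReal.add_ne_top.1 hmin.1).1
  refine ⟨Measurable.aestronglyMeasurable (by fun_prop), ?_⟩
  rw [hasFiniteIntegral_iff_ofReal (Eventually.of_forall fun p => by positivity)]
  refine lt_of_le_of_lt (lintegral_mono fun p => ?_)
    (ENNReal.lt_top_of_mul_ne_top_right hfin (by simp))
  rcases le_total 0 (K (p.1 - p.2)) with h | h
  · rw [max_eq_left h]
  · rw [max_eq_right h]; simp

lemma weak_equation_of_isLocalMinimizer {K W u φ : ℝ → ℝ} {s Lam R : ℝ} (hs0 : 0 < s)
    (hs1 : s < 1) (hK : Measurable K) (hJ : KernelBound (fun z => max (K z) 0) s Lam)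
    (hW : ContDiff ℝ 2 W) (hWnn : ∀ r, 0 ≤ W r) (hu : Continuous u) (hub : ∀ x, |u x| ≤ 1)
    (hmin : IsLocalMinimizer volume K W u (Ioo (-R) R))
    (hφ : ContDiff ℝ 1 φ) (hsupp : HasCompactSupport φ) (hφR : ∀ x, x ∉ Ioo (-R) R → φ x = 0) :
    Integrable (fun p : ℝ × ℝ => (u p.1 - u p.2) * (φ p.1 - φ p.2) * max (K (p.1 - p.2)) 0)
      (volume.prod volume) ∧
    1 / 2 * ∫ p : ℝ × ℝ, (u p.1 - u p.2) * (φ p.1 - φ p.2) * max (K (p.1 - p.2)) 0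
        ∂(volume.prod volume) + ∫ x, deriv W (u x) * φ x = 0 := by
  set Ω := Ioo (-R) R
  set S : Set (ℝ × ℝ) := (Ωᶜ ×ˢ Ωᶜ)ᶜ
  have hSm : MeasurableSet S := (measurableSet_Ioo.compl.prod measurableSet_Ioo.compl).compl
  set f₀ : ℝ × ℝ → ℝ := fun p => (u p.1 - u p.2) ^ 2 * max (K (p.1 - p.2)) 0 with hf₀
  set f₁ : ℝ × ℝ → ℝ := fun p => (u p.1 - u p.2) * (φ p.1 - φ p.2) * max (K (p.1 - p.2)) 0 with hf₁
  set f₂ : ℝ × ℝ → ℝ := fun p => (φ p.1 - φ p.2) ^ 2 * max (K (p.1 - p.2)) 0 with hf₂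
  have hum := hu.measurable
  have hφm := hφ.continuous.measurable
  have i₀ : IntegrableOn f₀ S (volume.prod volume) :=
    integrable_energy_of_isLocalMinimizer hK hum hmin
  have i₂ : IntegrableOn f₂ S (volume.prod volume) :=
    (integrable_sq_sub_mul_kernel hs0 hs1 hJ hφ hsupp).integrableOn
  have i₁ : IntegrableOn f₁ S (volume.prod volume) := by
    refine (i₀.add i₂).mono' (Measurable.aestronglyMeasurable (by fun_prop))
      (Eventually.of_forall fun p => ?_)
    have hk : 0 ≤ max (K (p.1 - p.2)) 0 := le_max_right _ _
    simp only [Pi.add_apply, hf₀, hf₁, hf₂]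
    rw [norm_mul, Real.norm_of_nonneg hk, ← add_mul]
    refine mul_le_mul_of_nonneg_right ?_ hk
    rw [Real.norm_eq_abs, abs_le]
    constructor <;> nlinarith [sq_nonneg ((u p.1 - u p.2) + (φ p.1 - φ p.2)),
      sq_nonneg ((u p.1 - u p.2) - (φ p.1 - φ p.2)), sq_nonneg (u p.1 - u p.2),
      sq_nonneg (φ p.1 - φ p.2)]
  have hf₁S : S.indicator f₁ = f₁ := by
    refine indicator_eq_self.2 fun p hp => ?_
    by_contra hpS
    have hpS' : p ∈ Ωᶜ ×ˢ Ωᶜ := not_not.1 hpS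
    refine hp ?_
    simp [hf₁, hφR _ hpS'.1, hφR _ hpS'.2]
  have i₁' : Integrable f₁ (volume.prod volume) := by
    rw [← hf₁S]; exact (integrable_indicator_iff hSm).2 i₁
  have hI₁ : ∫ p in S, f₁ p ∂(volume.prod volume) = ∫ p, f₁ p ∂(volume.prod volume) := by
    rw [← integral_indicator hSm, hf₁S]
  have hIW : ∫ x in Ω, deriv W (u x) * φ x = ∫ x, deriv W (u x) * φ x :=
    setIntegral_eq_integral_of_forall_compl_eq_zero fun x hx => by rw [hφR x hx, mul_zero]
  refine ⟨i₁', ?_⟩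
  set a₀ := ∫ p in S, f₀ p ∂(volume.prod volume)
  set a₁ := ∫ p in S, f₁ p ∂(volume.prod volume) with ha₁
  set a₂ := ∫ p in S, f₂ p ∂(volume.prod volume)
  rw [← hI₁, ← hIW]
  set w : ℝ → ℝ := fun t => ∫ x in Ω, W (u x + t * φ x) with hw
  have hφc := hφ.continuous
  have hWc := hW.continuous
  have hexp : ∀ t, (fun p : ℝ × ℝ => ((u p.1 + t * φ p.1) - (u p.2 + t * φ p.2)) ^ 2 *
      max (K (p.1 - p.2)) 0) = fun p => f₀ p + 2 * t * f₁ p + t ^ 2 * f₂ p := by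
    intro t; funext p; simp only [hf₀, hf₁, hf₂]; ring
  have j₀₁ : ∀ t, IntegrableOn (fun p => f₀ p + 2 * t * f₁ p) S (volume.prod volume) :=
    fun t => i₀.add (i₁.const_mul (2 * t))
  have hsum : ∀ t, ∫ p in S, ((u p.1 + t * φ p.1) - (u p.2 + t * φ p.2)) ^ 2 *
      max (K (p.1 - p.2)) 0 ∂(volume.prod volume) = a₀ + 2 * t * a₁ + t ^ 2 * a₂ := by
    intro t
    rw [hexp t, integral_add (j₀₁ t) (i₂.const_mul (t ^ 2)),
      integral_add i₀ (i₁.const_mul (2 * t)), integral_const_mul, integral_const_mul]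
  have hexp : ∀ t, (fun p : ℝ × ℝ => ((u p.1 + t * φ p.1) - (u p.2 + t * φ p.2)) ^ 2 *
      max (K (p.1 - p.2)) 0) = fun p => f₀ p + 2 * t * f₁ p + t ^ 2 * f₂ p := by
    intro t; funext p; simp only [hf₀, hf₁, hf₂]; ring
  have j₀₁ : ∀ t, IntegrableOn (fun p => f₀ p + 2 * t * f₁ p) S (volume.prod volume) :=
    fun t => i₀.add (i₁.const_mul (2 * t))
  have hsum : ∀ t, ∫ p in S, ((u p.1 + t * φ p.1) - (u p.2 + t * φ p.2)) ^ 2 *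
      max (K (p.1 - p.2)) 0 ∂(volume.prod volume) = a₀ + 2 * t * a₁ + t ^ 2 * a₂ := by
    intro t
    rw [hexp t, integral_add (j₀₁ t) (i₂.const_mul (t ^ 2)),
      integral_add i₀ (i₁.const_mul (2 * t)), integral_const_mul, integral_const_mul]
  have henergy : ∀ t, nlEnergy volume K W (fun x => u x + t * φ x) Ω =
      ENNReal.ofReal (1 / 4 * (a₀ + 2 * t * a₁ + t ^ 2 * a₂) + w t) := by
    intro t
    rw [nlEnergy_eq_ofReal hWnn, hsum t]
    · rw [hexp t]; exact (j₀₁ t).add (i₂.const_mul (t ^ 2))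
    · exact (Continuous.integrableOn_Icc (by fun_prop)).mono_set Ioo_subset_Icc_self
  have hnn : ∀ t, 0 ≤ 1 / 4 * (a₀ + 2 * t * a₁ + t ^ 2 * a₂) + w t := by
    intro t
    have h2 := integral_nonneg (μ := (volume.prod volume).restrict S) (f := fun p : ℝ × ℝ =>
      ((u p.1 + t * φ p.1) - (u p.2 + t * φ p.2)) ^ 2 * max (K (p.1 - p.2)) 0)
      (fun p => by positivity)
    have h3 : 0 ≤ w t := integral_nonneg fun x => hWnn _
    rw [hsum t] at h2
    linarith
  have hlocmin : IsLocalMin (fun t => 1 / 4 * (a₀ + 2 * t * a₁ + t ^ 2 * a₂) + w t) 0 := by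
    refine Eventually.of_forall fun t => ?_
    have h0 := henergy 0
    have h1 := hmin.2 (fun x => u x + t * φ x) (by fun_prop)
      (Eventually.of_forall fun x hx => by rw [hφR x hx]; ring)
    rw [show (fun x => u x + 0 * φ x) = u by funext x; ring] at h0
    rw [h0, henergy t, ENNReal.ofReal_le_ofReal_iff (hnn t)] at h1
    exact h1
  have hquad : HasDerivAt (fun t : ℝ => 1 / 4 * (a₀ + 2 * t * a₁ + t ^ 2 * a₂)) (1 / 2 * a₁) 0 := by
    have h1 : HasDerivAt (fun t : ℝ => 2 * t * a₁) (2 * 1 * a₁) 0 :=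
      ((hasDerivAt_id (0 : ℝ)).const_mul 2).mul_const a₁
    have h2 : HasDerivAt (fun t : ℝ => t ^ 2 * a₂) ((2 : ℕ) * (0 : ℝ) ^ (2 - 1) * a₂) 0 :=
      (hasDerivAt_pow 2 (0 : ℝ)).mul_const a₂
    refine (((h1.const_add a₀).add h2).const_mul (1 / 4)).congr_deriv ?_
    norm_num; ring
  exact hlocmin.hasDerivAt_eq_zero
    (hquad.add (hasDerivAt_integral_potential hW hu hub hφc hsupp R))

lemma integral_form_eq_neg_integral_opLK {J u φ : ℝ → ℝ} {s Lam p : ℝ} (hs0 : 0 < s)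
    (hJ : KernelBound J s Lam) (hu : Continuous u)
    (hp : 2 * s < p) (hD : ∀ R, ∃ C, 0 ≤ C ∧ ∀ x, |x| ≤ R → ∀ z,
      |secondDiff u x z| ≤ C * min 1 (|z| ^ p))
    (hφ : Continuous φ) (hsupp : HasCompactSupport φ)
    (hint : Integrable (fun q : ℝ × ℝ => (u q.1 - u q.2) * (φ q.1 - φ q.2) * J (q.1 - q.2))
      (volume.prod volume)) :
    ∫ q : ℝ × ℝ, (u q.1 - u q.2) * (φ q.1 - φ q.2) * J (q.1 - q.2) ∂(volume.prod volume) =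
      -(2 * ∫ x, opLK volume J u x * φ x) := by
  have hφi : Integrable φ := hφ.integrable_of_hasCompactSupport hsupp
  have hint' : Integrable (fun q : ℝ × ℝ => (u (q.1 + q.2) - u q.1) * (φ (q.1 + q.2) - φ q.1) * J q.2)
      (volume.prod volume) := by
    have := (measurePreserving_incrementEquiv.integrable_comp_emb
      incrementEquiv.measurableEmbedding).2 hint
    simpa only [Function.comp_def, incrementEquiv_apply, add_sub_cancel_left] using this
  have hfub : Integrable (Function.uncurry fun x z => φ x * secondDiff u x z * J z)
      ((volume : Measure ℝ).prod volume) := by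
    obtain ⟨R, hR⟩ := hsupp.isBounded.exists_norm_le
    obtain ⟨C, hC0, hC⟩ := hD R
    refine ((hφi.norm.mul_prod (hJ.integrable_min hs0 hp)).const_mul C).mono' ?_
      (Eventually.of_forall fun q => ?_)
    · have := hJ.meas
      have := hu.measurable
      have := hφ.measurable
      refine Measurable.aestronglyMeasurable ?_
      unfold secondDiff Function.uncurry
      fun_prop
    · obtain ⟨x, z⟩ := q
      simp only [Function.uncurry]
      rw [norm_mul, norm_mul, Real.norm_of_nonneg (hJ.nonneg z)]
      by_cases hx : x ∈ tsupport φ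
      · have h1 := hC x (hR x hx) z
        have h2 := mul_nonneg (norm_nonneg (φ x)) (hJ.nonneg z)
        rw [Real.norm_eq_abs (secondDiff u x z)]
        nlinarith [mul_le_mul_of_nonneg_right h1 h2]
      · simp [image_eq_zero_of_notMem_tsupport hx]
  have hinner : ∀ z, ∫ x, (u (x + z) - u x) * (φ (x + z) - φ x) * J z =
      -∫ x, φ x * secondDiff u x z * J z := by
    intro z
    have hmulφ : ∀ v : ℝ → ℝ, Continuous v → Integrable (fun x => v x * φ x) := fun v hv =>
      (hv.mul hφ).integrable_of_hasCompactSupport hsupp.mul_left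
    have k1 : Integrable (fun x => (u x - u (x - z)) * φ x) := hmulφ _ (by fun_prop)
    have k2 : Integrable (fun x => (u (x + z) - u x) * φ x) := hmulφ _ (by fun_prop)
    have k1' : Integrable (fun x => (u (x + z) - u x) * φ (x + z)) := by
      simpa using k1.comp_add_right z
    have e1 : ∫ x, (u (x + z) - u x) * φ (x + z) = ∫ x, (u x - u (x - z)) * φ x := by
      simpa using integral_add_right_eq_self (μ := volume) (fun x => (u x - u (x - z)) * φ x) z
    rw [integral_mul_const, integral_mul_const, ← neg_mul]
    congr 1
    simp_rw [mul_sub]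
    rw [integral_sub k1' k2, e1, ← integral_sub k1 k2, ← integral_neg]
    refine integral_congr_ae (Eventually.of_forall fun x => ?_)
    simp only [secondDiff]; ring
  rw [← measurePreserving_incrementEquiv.integral_comp incrementEquiv.measurableEmbedding]
  simp only [incrementEquiv_apply, add_sub_cancel_left]
  rw [integral_prod_symm _ hint']
  simp only [hinner]
  rw [integral_neg, ← integral_integral_swap hfub, ← integral_const_mul]
  congr 1
  refine integral_congr_ae (Eventually.of_forall fun x => ?_)
  simp only [mul_assoc]
  rw [integral_const_mul, opLK]
  simp only [secondDiff]
  ring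

lemma continuous_opLK {J u : ℝ → ℝ} {s Lam p : ℝ} (hs0 : 0 < s)
    (hJ : KernelBound J s Lam) (hu : Continuous u)
    (hp : 2 * s < p) (hD : ∀ R, ∃ C, 0 ≤ C ∧ ∀ x, |x| ≤ R → ∀ z,
      |secondDiff u x z| ≤ C * min 1 (|z| ^ p)) :
    Continuous (opLK volume J u) := by
  refine continuous_const.mul (continuous_iff_continuousAt.2 fun x₀ => ?_)
  obtain ⟨C, hC0, hC⟩ := hD (|x₀| + 1)
  have hum := hu.measurable
  have hJm := hJ.meas
  refine continuousAt_of_dominated (bound := fun z => C * (min 1 (|z| ^ p) * J z))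
    (Eventually.of_forall fun x => Measurable.aestronglyMeasurable (by fun_prop)) ?_
    ((hJ.integrable_min hs0 hp).const_mul C)
    (Eventually.of_forall fun z => Continuous.continuousAt (by fun_prop))
  have : ∀ᶠ x in 𝓝 x₀, |x| < |x₀| + 1 :=
    continuous_abs.continuousAt.eventually_lt_const (by linarith)
  filter_upwards [this] with x hx
  refine Eventually.of_forall fun z => ?_
  rw [norm_mul, Real.norm_of_nonneg (hJ.nonneg z), ← mul_assoc]
  exact mul_le_mul_of_nonneg_right (hC x hx.le z) (hJ.nonneg z)

lemma opLK_eq_of_isClassAMinimizer {K W u : ℝ → ℝ} {s Lam p : ℝ} (hs0 : 0 < s)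
    (hs1 : s < 1) (hK : Measurable K) (hJ : KernelBound (fun z => max (K z) 0) s Lam)
    (hW : ContDiff ℝ 2 W) (hWnn : ∀ r, 0 ≤ W r) (hu : Continuous u) (hub : ∀ x, |u x| ≤ 1)
    (hp : 2 * s < p) (hD : ∀ R, ∃ C, 0 ≤ C ∧ ∀ x, |x| ≤ R → ∀ z,
      |secondDiff u x z| ≤ C * min 1 (|z| ^ p))
    (hmin : IsClassAMinimizer volume K W u) (x : ℝ) :
    opLK volume (fun z => max (K z) 0) u x = deriv W (u x) := by
  have hW' : Continuous (deriv W) := hW.continuous_deriv (by norm_num)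
  have hL := continuous_opLK hs0 hJ hu hp hD
  have hcont : Continuous fun x => deriv W (u x) - opLK volume (fun z => max (K z) 0) u x := by
    fun_prop
  have hae := ae_eq_zero_of_integral_contDiff_smul_eq_zero (μ := volume)
    hcont.locallyIntegrable fun φ hφ hsupp => by
      obtain ⟨R, hR0, hR⟩ := hsupp.isBounded.exists_pos_norm_lt
      have hφR : ∀ x, x ∉ Ioo (-R) R → φ x = 0 := fun x hx =>
        image_eq_zero_of_notMem_tsupport fun h => hx (abs_lt.1 (hR x h))
      obtain ⟨hint, heq⟩ := weak_equation_of_isLocalMinimizer hs0 hs1 hK hJ hW hWnn hu hub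
        (hmin _ isOpen_Ioo (isConnected_Ioo (by linarith)) (Metric.isBounded_Ioo (-R) R))
        (hφ.of_le (by exact_mod_cast le_top)) hsupp hφR
      rw [integral_form_eq_neg_integral_opLK hs0 hJ hu hp hD hφ.continuous hsupp hint] at heq
      have i1 : Integrable fun x => deriv W (u x) * φ x :=
        ((hW'.comp hu).mul hφ.continuous).integrable_of_hasCompactSupport hsupp.mul_left
      have i2 : Integrable fun x => opLK volume (fun z => max (K z) 0) u x * φ x :=
        (hL.mul hφ.continuous).integrable_of_hasCompactSupport hsupp.mul_left
      simp only [smul_eq_mul, mul_comm (φ _), sub_mul]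
      rw [integral_sub i1 i2]
      linarith
  have := (hcont.ae_eq_iff_eq volume continuous_const).1 hae
  exact (sub_eq_zero.1 (congrFun this x)).symm

/-- Decay estimates for the one-dimensional minimizer `u₀` and its derivative:
`|u₀(x) - sign x| ≤ C |x|^{-2s}` and `|u₀'(x)| ≤ C |x|^{-1-2s}` for large `|x|`. -/
theorem theorem1_decay_estimates
    (s lam Lam r0 : ℝ) (hs0 : 0 < s) (hs1 : s < 1)
    (hlam : 0 < lam) (hlamLam : lam ≤ Lam) (hr0 : 0 < r0)
    (K : ℝ → ℝ) (hKmeas : Measurable K)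
    (hK1 : KernelSymm volume K) (hK2 : KernelK2 volume K 1 s lam Lam r0)
    (W : ℝ → ℝ) (hWreg : ∃ β > 0, IsC2HolderLoc β W)
    (hWnonneg : ∀ r, 0 ≤ W r)
    (hW1 : ∀ r ∈ Ioo (-1 : ℝ) 1, 0 < W r)
    (hW2a : W 1 = 0) (hW2b : W (-1) = 0)
    (hW2c : deriv W 1 = 0) (hW2d : deriv W (-1) = 0)
    (hW3a : 0 < deriv (deriv W) 1) (hW3b : 0 < deriv (deriv W) (-1))
    (hW4 : ∀ r ∈ Icc (-1 : ℝ) 1, W (-r) = W r)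
    -- `u₀` is the minimizer given by Theorem 1:
    (u0 : ℝ → ℝ)
    (hu0range : ∀ x, u0 x ∈ Ioo (-1 : ℝ) 1)
    (hu0odd : ∀ x, u0 (-x) = -u0 x)
    (hu0mono : StrictMono u0)
    (hu0zero : u0 0 = 0)
    (hu0top : Tendsto u0 atTop (𝓝 1)) (hu0bot : Tendsto u0 atBot (𝓝 (-1)))
    (hu0reg : ∃ α > 0, IsCHolder (1 + 2 * s + α) u0)
    (hu0min : IsClassAMinimizer volume K W u0)
    (hu0sol : ∀ x : ℝ, opLK volume K u0 x = deriv W (u0 x))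
    :
    ∃ C : ℝ, 1 ≤ C ∧ ∃ R1 : ℝ, 0 < R1 ∧ ∀ x : ℝ, R1 ≤ |x| →
      |u0 x - (if 0 < x then (1 : ℝ) else -1)| ≤ C * |x| ^ (-(2 * s)) ∧
      |deriv u0 x| ≤ C * |x| ^ (-(1 : ℝ) - 2 * s) := by
  have hLam : 0 < Lam := hlam.trans_le hlamLam
  have hJ : KernelBound (fun z => max (K z) 0) s Lam := by
    refine ⟨hKmeas.max measurable_const, fun z => le_max_right _ _, ?_⟩
    filter_upwards [hK2] with z hz
    refine max_le ?_ (by positivity)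
    simpa using hz.1
  have hub : ∀ x, |u0 x| ≤ 1 := fun x => abs_le.2 ⟨(hu0range x).1.le, (hu0range x).2.le⟩
  have hW : ContDiff ℝ 2 W := by
    obtain ⟨β, -, h⟩ := hWreg
    exact h.1
  obtain ⟨α, hα, hu0C⟩ := hu0reg
  have hu : ContDiff ℝ 1 u0 := by
    refine hu0C.1.of_le ?_
    exact_mod_cast Nat.le_floor (by push_cast; linarith)
  obtain ⟨p, hp, hD⟩ := hu0C.exists_abs_secondDiff_le hs0 hs1 hα hub
  have heq := opLK_eq_of_isClassAMinimizer hs0 hs1 hKmeas hJ hW hWnonneg hu.continuous hub hp hD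
    hu0min
  obtain ⟨C, hC, R, hR, hd⟩ := exists_deriv_le_of_opLK_eq hs0 hs1 hLam hJ hW hW3a hW3b hu
    hu0mono.monotone hu0top hu0bot hp hD heq
  have hone : ∀ x, R ≤ x → |u0 x - 1| ≤ C / (2 * s) * x ^ (-(2 * s)) := fun x hx => by
    rw [abs_sub_comm, abs_of_nonneg (by linarith [(hu0range x).2])]
    refine exists_one_sub_le_of_deriv_le hs0 hR (hu.differentiable one_ne_zero) hu0top
      (fun y hy => ?_) x hx
    simpa only [abs_of_pos (hR.trans_le hy)] using hd y (hy.trans (le_abs_self y))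
  have hCs : 0 ≤ C / (2 * s) := by positivity
  refine ⟨1 + C + C / (2 * s), by linarith, R, hR, fun x hx => ⟨?_, ?_⟩⟩
  · have hfirst : |u0 x - (if 0 < x then (1 : ℝ) else -1)| ≤ C / (2 * s) * |x| ^ (-(2 * s)) := by
      split_ifs with h
      · rw [abs_of_pos h] at hx ⊢
        exact hone x hx
      · rw [abs_of_nonpos (not_lt.1 h)] at hx ⊢
        have := hone (-x) hx
        rw [hu0odd, abs_sub_comm] at this
        rwa [show u0 x - -1 = 1 - -u0 x by ring]
    refine hfirst.trans (mul_le_mul_of_nonneg_right (by linarith) (by positivity))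
  · rw [abs_of_nonneg hu0mono.monotone.deriv_nonneg]
    exact (hd x hx).trans (mul_le_mul_of_nonneg_right (by linarith) (by positivity))

end
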